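/- For n ≥ 3, q(F_n) = (1/2)(n + 2 + √((n−2)² + 8)) if n is odd, and q(F_n) = (1/2)(n + 1 + √((n−1)² + 8)) if n is even. -/

import Mathlib

open SimpleGraph Finset

/-- The signless Laplacian matrix `Q(G) = D(G) + A(G)` of a finite simple graph. -/
noncomputable def signlessLapMatrix {V : Type*} [Fintype V] [DecidableEq V]
    (G : SimpleGraph V) : Matrix V V ℝ :=
  letI := Classical.decRel G.Adj
  Matrix.diagonal (fun v => (G.degree v : ℝ)) + G.adjMatrix ℝ

/-- The signless Laplacian spectral radius `q(G)`: the largest eigenvalue of `Q(G)`. -/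
noncomputable def qSpecRad {V : Type*} [Fintype V] [DecidableEq V]
    (G : SimpleGraph V) : ℝ :=
  sSup (spectrum ℝ (signlessLapMatrix G))

/-- The largest Laplacian eigenvalue `μ(G)`. -/
noncomputable def muSpecRad {V : Type*} [Fintype V] [DecidableEq V]
    (G : SimpleGraph V) : ℝ :=
  letI := Classical.decRel G.Adj
  sSup (spectrum ℝ (G.lapMatrix ℝ))

/-- `G` has a chorded cycle: a cycle together with an edge of `G` joining two
vertices of the cycle which is not an edge of the cycle. -/
def HasChordedCycle {V : Type*} (G : SimpleGraph V) : Prop :=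
  ∃ (v : V) (C : G.Walk v v), C.IsCycle ∧
    ∃ a b : V, a ∈ C.support ∧ b ∈ C.support ∧ G.Adj a b ∧ s(a, b) ∉ C.edges

/-- `F_{n,c}`: the star `K_{1,n-1}` with center `0` together with `c` pairwise
nonadjacent edges among the leaves, namely the edges `(2k+1, 2k+2)` for `k < c`. -/
def Fgraph (n c : ℕ) : SimpleGraph (Fin n) :=
  SimpleGraph.fromRel (fun i j =>
    i.val = 0 ∨ (j.val = i.val + 1 ∧ j.val % 2 = 0 ∧ j.val ≤ 2 * c))

/-- `H^{(n)}_{a₁,a₂,b₁,b₂}` (for `n = 3 + a₁ + 2a₂ + b₁ + 2b₂`): a triangle `u v w`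
(vertices `0, 1, 2`), with `a₁` pendant edges and `a₂` triangles attached at `u = 0`,
and `b₁` pendant edges and `b₂` triangles attached at `v = 1`. -/
def Hgraph (n a₁ a₂ b₁ b₂ : ℕ) : SimpleGraph (Fin n) :=
  SimpleGraph.fromRel (fun x y =>
    (x.val = 0 ∧ y.val = 1) ∨ (x.val = 0 ∧ y.val = 2) ∨ (x.val = 1 ∧ y.val = 2) ∨
    (x.val = 0 ∧ 3 ≤ y.val ∧ y.val < 3 + a₁ + 2 * a₂) ∨
    (3 + a₁ ≤ x.val ∧ y.val = x.val + 1 ∧ (x.val - (3 + a₁)) % 2 = 0 ∧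
      y.val < 3 + a₁ + 2 * a₂) ∨
    (x.val = 1 ∧ 3 + a₁ + 2 * a₂ ≤ y.val ∧ y.val < 3 + a₁ + 2 * a₂ + b₁ + 2 * b₂) ∨
    (3 + a₁ + 2 * a₂ + b₁ ≤ x.val ∧ y.val = x.val + 1 ∧
      (x.val - (3 + a₁ + 2 * a₂ + b₁)) % 2 = 0 ∧
      y.val < 3 + a₁ + 2 * a₂ + b₁ + 2 * b₂))

/-- `G` is a regular graph. -/
def IsRegularGraph {V : Type*} [Fintype V] (G : SimpleGraph V) : Prop :=
  letI := Classical.decRel G.Adj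
  ∃ d, G.IsRegularOfDegree d

/-- `G` is a semi-regular bipartite graph: there is a bipartition such that every edge
crosses it and vertices in the same part all have the same degree. -/
def IsSemiregularBipartite {V : Type*} [Fintype V] (G : SimpleGraph V) : Prop :=
  letI := Classical.decRel G.Adj
  ∃ (s : Set V) (d₁ d₂ : ℕ),
    (∀ ⦃a b⦄, G.Adj a b → (a ∈ s ↔ b ∉ s)) ∧
    (∀ a ∈ s, G.degree a = d₁) ∧ (∀ a ∉ s, G.degree a = d₂)

/-- An eigenvalue of an entrywise nonnegative matrix with a positive eigenvector bounds every
real eigenvalue from above. -/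
theorem Matrix.isGreatest_spectrum_of_pos_eigenvector {V : Type*} [Fintype V] [DecidableEq V]
    [Nonempty V] {M : Matrix V V ℝ} (hM : ∀ i j, 0 ≤ M i j) {v : V → ℝ} (hv : ∀ i, 0 < v i)
    {q : ℝ} (h : M.mulVec v = q • v) : IsGreatest (spectrum ℝ M) q := by
  have key (r : ℝ) : r ∈ spectrum ℝ M ↔ ∃ w : V → ℝ, M.mulVec w = r • w ∧ w ≠ 0 := by
    rw [← Matrix.spectrum_toLin', ← Module.End.hasEigenvalue_iff_mem_spectrum]
    constructor
    · intro hr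
      obtain ⟨w, hw⟩ := hr.exists_hasEigenvector
      exact ⟨w, by simpa using hw.apply_eq_smul, hw.2⟩
    · rintro ⟨w, hw, hw0⟩
      exact Module.End.hasEigenvalue_of_hasEigenvector
        (Module.End.hasEigenvector_iff.2 ⟨Module.End.mem_eigenspace_iff.2 (by simpa using hw), hw0⟩)
  refine ⟨(key q).2 ⟨v, h, fun h0 => ?_⟩, fun r hr => ?_⟩
  · obtain ⟨i⟩ := ‹Nonempty V›
    have := hv i
    simp [h0] at this
  · obtain ⟨w, hw, hw0⟩ := (key r).1 hr
    obtain ⟨i, hi⟩ := Finite.exists_max fun i => |w i| / v i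
    obtain ⟨k, hk⟩ := Function.ne_iff.1 hw0
    have hpos : 0 < |w i| / v i := (div_pos (abs_pos.2 hk) (hv k)).trans_le (hi k)
    have hwi : 0 < |w i| := (div_pos_iff_of_pos_right (hv i)).1 hpos
    refine le_of_mul_le_mul_right ?_ hwi
    calc r * |w i| ≤ |r * w i| := by
          rw [abs_mul]; exact mul_le_mul_of_nonneg_right (le_abs_self r) hwi.le
      _ = |∑ j, M i j * w j| := by
          rw [← smul_eq_mul, ← Pi.smul_apply, ← hw]; rfl
      _ ≤ ∑ j, M i j * (|w i| / v i * v j) := by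
          refine (Finset.abs_sum_le_sum_abs _ _).trans (Finset.sum_le_sum fun j _ => ?_)
          rw [abs_mul, abs_of_nonneg (hM i j)]
          exact mul_le_mul_of_nonneg_left ((div_le_iff₀ (hv j)).1 (hi j)) (hM i j)
      _ = |w i| / v i * (M.mulVec v) i := by
          simp only [Matrix.mulVec, dotProduct, Finset.mul_sum]
          exact Finset.sum_congr rfl fun j _ => by ring
      _ = q * |w i| := by
          rw [h, Pi.smul_apply, smul_eq_mul]
          have := (hv i).ne'
          field_simp

theorem signlessLapMatrix_nonneg {V : Type*} [Fintype V] [DecidableEq V] (G : SimpleGraph V)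
    (i j : V) : 0 ≤ signlessLapMatrix G i j := by
  classical
  simp only [signlessLapMatrix, Matrix.add_apply, Matrix.diagonal_apply,
    SimpleGraph.adjMatrix_apply]
  split_ifs <;> positivity

theorem signlessLapMatrix_mulVec_apply {V : Type*} [Fintype V] [DecidableEq V]
    {G : SimpleGraph V} (v : V → ℝ) {i : V} {s : Finset V} (hs : ∀ j, G.Adj i j ↔ j ∈ s) :
    (signlessLapMatrix G).mulVec v i = ∑ j ∈ s, (v i + v j) := by
  classical
  have hN : G.neighborFinset i = s := by
    ext j
    rw [SimpleGraph.mem_neighborFinset, hs]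
  rw [signlessLapMatrix, Matrix.add_mulVec, Pi.add_apply, Matrix.mulVec_diagonal,
    SimpleGraph.adjMatrix_mulVec_apply, Finset.sum_add_distrib, Finset.sum_const, nsmul_eq_mul,
    ← hN, SimpleGraph.card_neighborFinset_eq_degree]

theorem qSpecRad_eq_of_pos_eigenvector {V : Type*} [Fintype V] [DecidableEq V] [Nonempty V]
    {G : SimpleGraph V} {v : V → ℝ} (hv : ∀ i, 0 < v i) {q : ℝ}
    (h : ∀ i, (signlessLapMatrix G).mulVec v i = q * v i) : qSpecRad G = q :=
  (Matrix.isGreatest_spectrum_of_pos_eigenvector (signlessLapMatrix_nonneg G) hv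
    (funext h)).csSup_eq

theorem Fgraph_adj_zero {n c : ℕ} {i : Fin n} (hi : i.val = 0) (j : Fin n) :
    (Fgraph n c).Adj i j ↔ j ∈ Finset.univ.erase i := by
  simp [Fgraph, SimpleGraph.fromRel_adj, hi, eq_comm]

/-- The neighbours of a vertex of `F_{n,c}` lying on a triangle. -/
theorem Fgraph_adj_triangle {n c : ℕ} {i z m : Fin n} (hz : z.val = 0) (hi : i.val ≠ 0)
    (hm : m.val = if i.val % 2 = 0 then i.val - 1 else i.val + 1)
    (hc : i.val ≤ 2 * c) (j : Fin n) :
    (Fgraph n c).Adj i j ↔ j ∈ ({z, m} : Finset (Fin n)) := by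
  simp only [Fgraph, SimpleGraph.fromRel_adj, Finset.mem_insert, Finset.mem_singleton, ne_eq,
    Fin.ext_iff]
  split_ifs at hm <;> omega

/-- The only neighbour of a pendant vertex of `F_{n,c}` is the centre. -/
theorem Fgraph_adj_pendant {n c : ℕ} {i z : Fin n} (hz : z.val = 0) (hi : 2 * c < i.val)
    (j : Fin n) : (Fgraph n c).Adj i j ↔ j ∈ ({z} : Finset (Fin n)) := by
  simp only [Fgraph, SimpleGraph.fromRel_adj, Finset.mem_singleton, ne_eq, Fin.ext_iff]
  omega

theorem qSpecRad_Fgraph_of_odd {k : ℕ} {q : ℝ} (hq : 3 < q)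
    (h : (q - 2 * k) * (q - 3) = 2 * k) : qSpecRad (Fgraph (2 * k + 1) k) = q := by
  refine qSpecRad_eq_of_pos_eigenvector (v := fun i => if i.val = 0 then q - 3 else 1)
    (fun i => by split_ifs <;> linarith) fun i => ?_
  by_cases hi : i.val = 0
  · obtain rfl : i = 0 := Fin.ext hi
    rw [signlessLapMatrix_mulVec_apply _ (Fgraph_adj_zero hi)]
    rw [Finset.sum_congr rfl (g := fun _ => q - 3 + 1)]
    · simp
      linarith
    · intro j hj
      have hj : j.val ≠ 0 := fun h0 => Finset.ne_of_mem_erase hj (Fin.ext h0)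
      simp [hj]
  · obtain ⟨m, hm⟩ : ∃ m : Fin (2 * k + 1),
        m.val = if i.val % 2 = 0 then i.val - 1 else i.val + 1 :=
      ⟨⟨if i.val % 2 = 0 then i.val - 1 else i.val + 1, by split_ifs <;> omega⟩, rfl⟩
    have hm0 : m.val ≠ 0 := by split_ifs at hm <;> omega
    rw [signlessLapMatrix_mulVec_apply _ (Fgraph_adj_triangle (z := 0) rfl hi hm (by omega)),
      Finset.sum_pair (fun h0 => hm0 (by rw [← h0]; rfl))]
    simp only [hi, hm0, Fin.val_zero, if_true, if_false]
    ring

theorem qSpecRad_Fgraph_of_even {k : ℕ} {q : ℝ} (hq : 3 < q)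
    (h : (q - (2 * k + 1)) * ((q - 3) * (q - 1)) = 2 * k * (q - 1) + (q - 3)) :
    qSpecRad (Fgraph (2 * k + 2) k) = q := by
  refine qSpecRad_eq_of_pos_eigenvector
    (v := fun i => if i.val = 0 then (q - 3) * (q - 1) else
      if i.val = 2 * k + 1 then q - 3 else q - 1)
    (fun i => by split_ifs <;> nlinarith) fun i => ?_
  by_cases hi : i.val = 0
  · obtain rfl : i = 0 := Fin.ext hi
    rw [signlessLapMatrix_mulVec_apply _ (Fgraph_adj_zero hi), Finset.sum_erase_eq_sub
      (Finset.mem_univ _), Fin.sum_univ_succ, Fin.sum_univ_castSucc]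
    have hne (x : Fin (2 * k)) : x.val ≠ 2 * k := x.2.ne
    simp [hne]
    linarith
  · by_cases hik : i.val = 2 * k + 1
    · rw [signlessLapMatrix_mulVec_apply _ (Fgraph_adj_pendant (z := 0) rfl (by omega)),
        Finset.sum_singleton]
      simp [hik]
      ring
    obtain ⟨m, hm⟩ : ∃ m : Fin (2 * k + 2),
        m.val = if i.val % 2 = 0 then i.val - 1 else i.val + 1 :=
      ⟨⟨if i.val % 2 = 0 then i.val - 1 else i.val + 1, by split_ifs <;> omega⟩, rfl⟩
    have hm0 : m.val ≠ 0 := by split_ifs at hm <;> omega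
    have hmk : m.val ≠ 2 * k + 1 := by split_ifs at hm <;> omega
    rw [signlessLapMatrix_mulVec_apply _ (Fgraph_adj_triangle (z := 0) rfl hi hm (by omega)),
      Finset.sum_pair (fun h0 => hm0 (by rw [← h0]; rfl))]
    simp only [hi, hik, hm0, hmk, Fin.val_zero, if_true, if_false]
    ring

theorem stmt12 (n : ℕ) (hn : 3 ≤ n) :
    (Odd n →
      qSpecRad (Fgraph n ((n - 1) / 2)) =
        ((n : ℝ) + 2 + Real.sqrt (((n : ℝ) - 2) ^ 2 + 8)) / 2) ∧
    (Even n →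
      qSpecRad (Fgraph n ((n - 1) / 2)) =
        ((n : ℝ) + 1 + Real.sqrt (((n : ℝ) - 1) ^ 2 + 8)) / 2) := by
  constructor
  · rintro ⟨k, rfl⟩
    have hk : (1 : ℝ) ≤ k := by exact_mod_cast (by omega : 1 ≤ k)
    rw [show (2 * k + 1 - 1) / 2 = k by omega]
    push_cast
    have hs := Real.sq_sqrt (show (0 : ℝ) ≤ (2 * k + 1 - 2) ^ 2 + 8 by positivity)
    have hlt : (2 * k + 1 - 2 : ℝ) < √((2 * k + 1 - 2) ^ 2 + 8) :=
      Real.lt_sqrt_of_sq_lt (by linarith)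
    refine qSpecRad_Fgraph_of_odd (by linarith) ?_
    linear_combination hs / 4
  · rintro ⟨l, rfl⟩
    obtain ⟨k, rfl⟩ : ∃ k, l = k + 1 := ⟨l - 1, by omega⟩
    have hk : (1 : ℝ) ≤ k := by exact_mod_cast (by omega : 1 ≤ k)
    rw [show (k + 1 + (k + 1) - 1) / 2 = k by omega, show k + 1 + (k + 1) = 2 * k + 2 by ring]
    push_cast
    have hs := Real.sq_sqrt (show (0 : ℝ) ≤ (2 * k + 2 - 1) ^ 2 + 8 by positivity)
    have hlt : (2 * k + 2 - 1 : ℝ) < √((2 * k + 2 - 1) ^ 2 + 8) :=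
      Real.lt_sqrt_of_sq_lt (by linarith)
    set s := √((2 * k + 2 - 1 : ℝ) ^ 2 + 8)
    refine qSpecRad_Fgraph_of_even (by linarith) ?_
    linear_combination ((2 * k + 2 + 1 + s) / 2 - 2) * hs / 4
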